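/- Interior homogeneity of the wave solution with non-oscillating homogeneous source: Let δ ∈ (0, 1/2), ε > 0, and let P : ℝ³ → ℝ be measurable with |P(y)| ≤ ε² (1 − |y|²)^{2−2δ} for |y| < 1 and P(y) = 0 for |y| ≥ 1. Define u(t,x) := (1/4π) ∫_2^t (t − s)^{−1} ∫_{{z : |z − x| = t − s}} s^{−3} P(z/s) dσ(z) ds for t ≥ 2, and Ũ(y) := (1/4π) ∫_0^1 ∫_{S²} (1 − λ) λ^{−3} P((y − (1−λ)η)/λ) dσ(η) dλ for |y| < 1. Then for every (t,x) with t − |x| > 4, one has u(t,x) = Ũ(x/t)/t. -/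

import Mathlib

noncomputable section

open Real MeasureTheory Metric

abbrev E3 : Type := EuclideanSpace ℝ (Fin 3)

/-- The standard surface measure on the unit sphere `S² ⊂ ℝ³`. -/
def sphereMeasure : Measure (sphere (0 : E3) 1) := volume.toSphere

/-- The integral of `F` over the sphere of center `x` and radius `R` with respect to
surface measure: `∫_{|z−x|=R} F(z) dσ(z) = R² ∫_{S²} F(x + Rω) dσ(ω)`. -/
def sphereIntegral (F : E3 → ℝ) (x : E3) (R : ℝ) : ℝ :=
  R ^ 2 * ∫ ω : sphere (0 : E3) 1, F (x + R • (ω : E3)) ∂sphereMeasure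

/-- The forward solution of `∂_t²u − Δu = t^{−3} P(x/t)` with vanishing data at `t = 2`,
given by the Duhamel/Kirchhoff formula. -/
def waveSol (P : E3 → ℝ) (t : ℝ) (x : E3) : ℝ :=
  (1 / (4 * π)) * ∫ s in Set.Ioo (2 : ℝ) t,
    (t - s)⁻¹ * sphereIntegral (fun z => s ^ (-3 : ℝ) * P (s⁻¹ • z)) x (t - s)

/-- The interior homogeneous profile
`Ũ(y) = (1/4π) ∫_0^1 ∫_{S²} (1 − λ) λ^{−3} P((y − (1−λ)η)/λ) dσ(η) dλ`. -/
def Utilde (P : E3 → ℝ) (y : E3) : ℝ :=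
  (1 / (4 * π)) * ∫ l in Set.Ioc (0 : ℝ) 1,
    ∫ η : sphere (0 : E3) 1, (1 - l) * l ^ (-3 : ℝ) * P (l⁻¹ • (y - (1 - l) • (η : E3)))
      ∂sphereMeasure

/-- The surface measure on the unit sphere is invariant under the antipodal map. -/
theorem measurePreserving_neg_sphereMeasure :
    MeasurePreserving (fun ω : sphere (0 : E3) 1 => -ω) sphereMeasure sphereMeasure := by
  refine ⟨continuous_neg.measurable, ?_⟩
  ext s hs
  have hs' : MeasurableSet ((fun ω : sphere (0 : E3) 1 => -ω) ⁻¹' s) :=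
    continuous_neg.measurable hs
  rw [Measure.map_apply continuous_neg.measurable hs, sphereMeasure,
    Measure.toSphere_apply' _ hs, Measure.toSphere_apply' _ hs']
  congr 1
  rw [← Measure.measure_neg]
  congr 1
  ext v
  simp only [Set.mem_neg, Set.mem_smul, Set.mem_image, Set.mem_preimage]
  constructor
  · rintro ⟨r, hr, _, ⟨ω, hω, rfl⟩, h⟩
    exact ⟨r, hr, _, ⟨-ω, hω, rfl⟩, by simp [h]⟩
  · rintro ⟨r, hr, _, ⟨ω, hω, rfl⟩, h⟩
    exact ⟨r, hr, _, ⟨-ω, by simpa using hω, rfl⟩, by simp [h]⟩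

theorem integral_neg_sphereMeasure (f : sphere (0 : E3) 1 → ℝ) :
    ∫ ω, f (-ω) ∂sphereMeasure = ∫ ω, f ω ∂sphereMeasure :=
  measurePreserving_neg_sphereMeasure.integral_comp
    (Homeomorph.neg (sphere (0 : E3) 1)).measurableEmbedding f

/-- The inner spherical integral in the definition of `Utilde`. -/
def profileIntegrand (P : E3 → ℝ) (y : E3) (l : ℝ) : ℝ :=
  ∫ η : sphere (0 : E3) 1, (1 - l) * l ^ (-3 : ℝ) * P (l⁻¹ • (y - (1 - l) • (η : E3)))
    ∂sphereMeasure

theorem profileIntegrand_eq_zero {P : E3 → ℝ} (hPsupp : ∀ y : E3, 1 ≤ ‖y‖ → P y = 0)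
    {y : E3} {l : ℝ} (hl : 0 < l) (hly : 2 * l ≤ 1 - ‖y‖) : profileIntegrand P y l = 0 := by
  refine integral_eq_zero_of_ae (Filter.Eventually.of_forall fun η => ?_)
  have hη : ‖(η : E3)‖ = 1 := norm_eq_of_mem_sphere η
  have hl1 : 0 ≤ 1 - l := by linarith [norm_nonneg y]
  have hdist : l ≤ ‖y - (1 - l) • (η : E3)‖ := by
    have h := norm_sub_norm_le ((1 - l) • (η : E3)) y
    rw [norm_smul, hη, Real.norm_of_nonneg hl1, norm_sub_rev] at h
    linarith
  have hP : P (l⁻¹ • (y - (1 - l) • (η : E3))) = 0 := by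
    apply hPsupp
    rw [norm_smul, norm_inv, Real.norm_of_nonneg hl.le, inv_mul_eq_div]
    exact (one_le_div hl).2 hdist
  simp [hP]

/-- The Duhamel integrand rescaled to the variable `λ = s / t`. -/
theorem duhamel_integrand_eq (P : E3 → ℝ) (x : E3) {s t : ℝ} (hs : 0 < s) (hst : s < t) :
    (t - s)⁻¹ * sphereIntegral (fun z => s ^ (-3 : ℝ) * P (s⁻¹ • z)) x (t - s) =
      (t ^ 2)⁻¹ * profileIntegrand P (t⁻¹ • x) (t⁻¹ * s) := by
  have ht : 0 < t := hs.trans hst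
  have hts : t - s ≠ 0 := (sub_pos.2 hst).ne'
  rw [profileIntegrand, ← integral_neg_sphereMeasure, sphereIntegral, integral_const_mul,
    integral_const_mul]
  have harg : ∀ ω : sphere (0 : E3) 1,
      (t⁻¹ * s)⁻¹ • (t⁻¹ • x - (1 - t⁻¹ * s) • ((-ω : sphere (0 : E3) 1) : E3)) =
        s⁻¹ • (x + (t - s) • (ω : E3)) := by
    intro ω
    ext i
    simp only [coe_neg_sphere, PiLp.smul_apply, PiLp.sub_apply, PiLp.add_apply, PiLp.neg_apply,
      smul_eq_mul]
    field_simp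
    ring
  simp only [harg]
  have hpow : ∀ r : ℝ, 0 < r → r ^ (-3 : ℝ) = (r ^ 3)⁻¹ := by
    intro r hr
    rw [Real.rpow_neg hr.le]
    norm_cast
  rw [hpow s hs, hpow _ (by positivity)]
  field_simp

/-- Interior homogeneity of the wave solution with non-oscillating homogeneous source:
in the region `{t − |x| > 4}` one has `u(t,x) = Ũ(x/t)/t`. -/
theorem interior_homogeneity_wave_solution (δ ε : ℝ) (hδ : δ ∈ Set.Ioo (0 : ℝ) (1 / 2))
    (hε : 0 < ε) (P : E3 → ℝ) (hP : Measurable P)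
    (hPbound : ∀ y : E3, ‖y‖ < 1 → |P y| ≤ ε ^ 2 * (1 - ‖y‖ ^ 2) ^ (2 - 2 * δ))
    (hPsupp : ∀ y : E3, 1 ≤ ‖y‖ → P y = 0) :
    ∀ (t : ℝ) (x : E3), 4 < t - ‖x‖ → waveSol P t x = Utilde P (t⁻¹ • x) / t := by
  intro t x htx
  have ht : 4 < t := by linarith [norm_nonneg x]
  have ht0 : 0 < t := by linarith
  have ht1 : 2 / t ≤ 1 := (div_le_one ht0).2 (by linarith)
  have hduhamel : ∫ s in Set.Ioo (2 : ℝ) t,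
      (t - s)⁻¹ * sphereIntegral (fun z => s ^ (-3 : ℝ) * P (s⁻¹ • z)) x (t - s) =
      t⁻¹ * ∫ l in Set.Ioc (2 / t) 1, profileIntegrand P (t⁻¹ • x) l := by
    rw [setIntegral_congr_fun measurableSet_Ioo fun s hs =>
      duhamel_integrand_eq P x (by linarith [hs.1]) hs.2]
    rw [integral_const_mul, ← integral_Ioc_eq_integral_Ioo,
      ← intervalIntegral.integral_of_le (by linarith), ← intervalIntegral.integral_of_le ht1,
      intervalIntegral.integral_comp_mul_left _ (inv_ne_zero ht0.ne'), inv_mul_cancel₀ ht0.ne',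
      inv_mul_eq_div, smul_eq_mul]
    field_simp
  have hvanish : ∫ l in Set.Ioc (0 : ℝ) 1, profileIntegrand P (t⁻¹ • x) l =
      ∫ l in Set.Ioc (2 / t) 1, profileIntegrand P (t⁻¹ • x) l := by
    refine setIntegral_eq_of_subset_of_forall_sdiff_eq_zero measurableSet_Ioc
      (Set.Ioc_subset_Ioc_left (by positivity)) fun l hl => ?_
    have hl2 : l ≤ 2 / t := by
      by_contra! h
      exact hl.2 ⟨h, hl.1.2⟩
    refine profileIntegrand_eq_zero hPsupp hl.1.1 ?_
    rw [norm_smul, norm_inv, Real.norm_of_nonneg ht0.le]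
    have hbound : 4 / t ≤ 1 - t⁻¹ * ‖x‖ := by
      rw [div_le_iff₀ ht0]
      field_simp
      linarith
    have hfour : 4 / t = 2 * (2 / t) := by ring
    linarith
  change _ = (1 / (4 * π)) * (∫ l in Set.Ioc (0 : ℝ) 1, profileIntegrand P (t⁻¹ • x) l) / t
  rw [waveSol, hduhamel, hvanish]
  ring
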